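/- Let F be a group, let G₁,…,G_k be finite irreducible F-groups that are pairwise non-isomorphic as F-groups, let m₁,…,m_k be non-negative integers, let R = ∏_{i=1}^k G_i^{m_i}, and let N be a positive integer. Then the number of N-tuples (x₁,…,x_N) ∈ R^N with [x₁,…,x_N]_F = R equals ∏_{i : G_i abelian} ∏_{j=0}^{m_i−1} (|G_i|^N − h_F(G_i)^j) · ∏_{i : G_i non-abelian} (|G_i|^N − 1)^{m_i}, as an identity of integers. -/

import Mathlib

section FGroupDefs

variable (F : Type*) [Group F]

/-- A subgroup of an `F`-group is a *normal `F`-subgroup* if it is normal and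
stable under the `F`-action. -/
def IsNormalFSubgroup {G : Type*} [Group G] [MulDistribMulAction F G]
    (H : Subgroup G) : Prop :=
  H.Normal ∧ ∀ (f : F) (x : G), x ∈ H → f • x ∈ H

/-- An *irreducible `F`-group* is a nontrivial `F`-group whose only normal
`F`-subgroups are the trivial subgroup and the whole group. -/
def IsIrreducibleFGroup (G : Type*) [Group G] [MulDistribMulAction F G] : Prop :=
  Nontrivial G ∧ ∀ H : Subgroup G, IsNormalFSubgroup F H → H = ⊥ ∨ H = ⊤

/-- `[s]_F`: the smallest normal `F`-subgroup containing the set `s`. -/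
def normalFClosure {G : Type*} [Group G] [MulDistribMulAction F G] (s : Set G) :
    Subgroup G :=
  sInf {H : Subgroup G | IsNormalFSubgroup F H ∧ s ⊆ H}

/-- A group homomorphism is an `F`-group morphism if it commutes with the `F`-actions. -/
def IsFHom {G G' : Type*} [Group G] [Group G'] [MulDistribMulAction F G]
    [MulDistribMulAction F G'] (φ : G →* G') : Prop :=
  ∀ (f : F) (x : G), φ (f • x) = f • φ x

/-- `h_F(G)`: the number of `F`-group endomorphisms of `G`. -/
noncomputable def hF (G : Type*) [Group G] [MulDistribMulAction F G] : ℕ :=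
  Nat.card {φ : G →* G // IsFHom F φ}

/-- Two `F`-groups are isomorphic if there is a bijective group homomorphism
between them commuting with the `F`-actions. -/
def IsFIso (G G' : Type*) [Group G] [Group G'] [MulDistribMulAction F G]
    [MulDistribMulAction F G'] : Prop :=
  ∃ e : G ≃* G', ∀ (f : F) (x : G), e (f • x) = f • e x

end FGroupDefs

section Helpers

variable (F : Type*) [Group F]

/-- `x` generates `G` as a normal `F`-subgroup. -/
def FGen {G : Type*} [Group G] [MulDistribMulAction F G] {N : ℕ} (x : Fin N → G) : Prop :=
  ∀ H : Subgroup G, IsNormalFSubgroup F H → (∀ n, x n ∈ H) → H = ⊤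

theorem normalFClosure_eq_top_iff {G : Type*} [Group G] [MulDistribMulAction F G] {N : ℕ}
    (x : Fin N → G) : normalFClosure F (Set.range x) = ⊤ ↔ FGen F x := by
  unfold normalFClosure FGen
  rw [sInf_eq_top]
  constructor
  · intro h H hH hx
    exact h H ⟨hH, by rintro _ ⟨n, rfl⟩; exact hx n⟩
  · rintro h H ⟨hH, hx⟩
    exact h H hH (fun n => hx ⟨n, rfl⟩)

/-- Equivariant homs with central image. -/
def CHom (S G : Type*) [Group S] [Group G] [MulDistribMulAction F S]
    [MulDistribMulAction F G] : Type _ :=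
  {φ : S →* G // IsFHom F φ ∧ ∀ s g, φ s * g = g * φ s}

section
variable {S S' T G : Type*} [Group S] [Group S'] [Group T] [Group G]
  [MulDistribMulAction F S] [MulDistribMulAction F S']
  [MulDistribMulAction F T] [MulDistribMulAction F G]

instance [Finite S] [Finite G] : Finite (CHom F S G) := by
  have : Finite (S →* G) := Finite.of_injective _ DFunLike.coe_injective
  unfold CHom
  infer_instance

theorem isNormalF_comap (φ : S →* T) (hφ : IsFHom F φ) {H : Subgroup T}
    (hH : IsNormalFSubgroup F H) : IsNormalFSubgroup F (H.comap φ) := by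
  refine ⟨hH.1.comap φ, fun f x hx => ?_⟩
  rw [Subgroup.mem_comap] at *
  rw [hφ]
  exact hH.2 f _ hx

theorem isNormalF_map (φ : S →* T) (hφ : IsFHom F φ) (hs : Function.Surjective φ)
    {H : Subgroup S}
    (hH : IsNormalFSubgroup F H) : IsNormalFSubgroup F (H.map φ) := by
  refine ⟨hH.1.map φ hs, ?_⟩
  rintro f _ ⟨x, hx, rfl⟩
  exact ⟨f • x, hH.2 f _ hx, hφ f x⟩

theorem isNormalF_ker (φ : S →* T) (hφ : IsFHom F φ) : IsNormalFSubgroup F φ.ker := by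
  refine ⟨inferInstance, fun f x hx => ?_⟩
  rw [MonoidHom.mem_ker] at *
  rw [hφ, hx, smul_one]

theorem FGen.map {N : ℕ} {x : Fin N → S} (hx : FGen F x) (φ : S →* T) (hφ : IsFHom F φ)
    (hs : Function.Surjective φ) : FGen F (fun n => φ (x n)) := by
  intro H hH hn
  have := hx _ (isNormalF_comap F φ hφ hH) hn
  rw [eq_top_iff]
  intro t _
  obtain ⟨s, rfl⟩ := hs t
  have : s ∈ H.comap φ := this ▸ Subgroup.mem_top s
  exact this

theorem isFHom_symm (e : S ≃* T) (he : ∀ (f : F) (x : S), e (f • x) = f • e x) (f : F) (y : T) :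
    e.symm (f • y) = f • e.symm y := by
  apply e.injective
  rw [he]; simp

theorem card_gen_congr (N : ℕ) (e : S ≃* T) (he : ∀ (f : F) (x : S), e (f • x) = f • e x) :
    Nat.card {x : Fin N → S // FGen F x} = Nat.card {x : Fin N → T // FGen F x} := by
  refine Nat.card_congr (Equiv.subtypeEquiv (Equiv.arrowCongr (Equiv.refl _) e.toEquiv) ?_)
  intro x
  constructor
  · intro h
    exact FGen.map F h e.toMonoidHom he e.surjective
  · intro h
    have := FGen.map F h e.symm.toMonoidHom (isFHom_symm F e he) e.symm.surjective
    convert this using 2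
    simp

theorem card_chom_congr (e : S ≃* T) (he : ∀ (f : F) (x : S), e (f • x) = f • e x) :
    Nat.card (CHom F S G) = Nat.card (CHom F T G) := by
  refine Nat.card_congr ⟨
    fun φ => ⟨φ.1.comp e.symm.toMonoidHom, ?_, fun s g => φ.2.2 _ g⟩,
    fun φ => ⟨φ.1.comp e.toMonoidHom, ?_, fun s g => φ.2.2 _ g⟩, ?_, ?_⟩
  · intro f x
    simp [isFHom_symm F e he, φ.2.1 f]
  · intro f x
    simp [he, φ.2.1 f]
  · intro φ
    apply Subtype.ext
    ext x
    simp
  · intro φ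
    apply Subtype.ext
    ext x
    simp

theorem card_chom_prod :
    Nat.card (CHom F (S × T) G) = Nat.card (CHom F S G) * Nat.card (CHom F T G) := by
  rw [← Nat.card_prod]
  refine Nat.card_congr ⟨
    fun φ => (⟨φ.1.comp (MonoidHom.inl S T), ?_, fun s g => φ.2.2 _ g⟩,
      ⟨φ.1.comp (MonoidHom.inr S T), ?_, fun s g => φ.2.2 _ g⟩),
    fun p => ⟨⟨⟨fun x => p.1.1 x.1 * p.2.1 x.2, by simp⟩, ?_⟩, ?_, ?_⟩, ?_, ?_⟩
  · intro f x
    have := φ.2.1 f (x, 1)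
    simpa using this
  · intro f x
    have := φ.2.1 f (1, x)
    simpa using this
  · intro x y
    have := p.2.2.2 x.2 (p.1.1 y.1)
    simp only [Prod.fst_mul, Prod.snd_mul, map_mul]
    rw [mul_assoc, mul_assoc, ← mul_assoc (p.1.1 y.1), ← this, mul_assoc]
  · intro f x
    simp [p.1.2.1 f, p.2.2.1 f, smul_mul']
  · intro s g
    have h1 := p.1.2.2 s.1 g
    have h2 := p.2.2.2 s.2 g
    simp only [MonoidHom.coe_mk, OneHom.coe_mk]
    rw [mul_assoc, h2, ← mul_assoc, h1, mul_assoc]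
  · intro φ
    apply Subtype.ext
    ext x
    simp [← map_mul]
  · intro p
    refine Prod.ext (Subtype.ext ?_) (Subtype.ext ?_) <;> ext x <;> simp

theorem gen_prod_iff {N : ℕ} (hG : IsIrreducibleFGroup F G) (s : Fin N → S) (g : Fin N → G) :
    FGen F (fun n => (s n, g n)) ↔
      FGen F s ∧ ¬ ∃ φ : CHom F S G, (fun n => φ.1 (s n)) = g := by
  constructor
  · intro h
    refine ⟨FGen.map F h (MonoidHom.fst S G) (fun _ _ => rfl) Prod.fst_surjective, ?_⟩
    rintro ⟨φ, rfl⟩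
    -- kernel of (s, g) ↦ φ s⁻¹ * g
    let K : Subgroup (S × G) :=
      { carrier := {p | φ.1 p.1 = p.2}
        one_mem' := by simp
        mul_mem' := by
          intro a b ha hb
          simp only [Set.mem_ofPred_eq] at *
          simp [ha, hb]
        inv_mem' := by
          intro a ha
          simp only [Set.mem_ofPred_eq] at *
          simp [ha] }
    have hK : IsNormalFSubgroup F K := by
      refine ⟨⟨?_⟩, ?_⟩
      · intro a ha b
        change φ.1 a.1 = a.2 at ha
        change φ.1 (b.1 * a.1 * b.1⁻¹) = b.2 * a.2 * b.2⁻¹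
        rw [← ha, ← φ.2.2 a.1 b.2, map_mul, map_mul, ← φ.2.2 a.1, map_inv]
        simp
      · intro f a ha
        change φ.1 a.1 = a.2 at ha
        change φ.1 (f • a.1) = f • a.2
        rw [φ.2.1, ha]
    have hT := h K hK (fun n => rfl)
    obtain ⟨a, ha⟩ := (have := hG.1; exists_ne (1 : G))
    have : ((1 : S), a) ∈ K := hT ▸ Subgroup.mem_top _
    change φ.1 1 = a at this
    rw [map_one] at this
    exact ha this.symm
  · rintro ⟨hs, hφ⟩ H hH hx
    have hfst := hs _ (isNormalF_map F (MonoidHom.fst S G) (fun _ _ => rfl)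
      Prod.fst_surjective hH) (fun n => ⟨_, hx n, rfl⟩)
    have hsurj : ∀ a : S, ∃ b : G, (a, b) ∈ H := by
      intro a
      have : a ∈ H.map (MonoidHom.fst S G) := hfst ▸ Subgroup.mem_top a
      obtain ⟨⟨a', b⟩, hb, rfl⟩ := this
      exact ⟨b, hb⟩
    have hcap := hG.2 (H.comap (MonoidHom.inr S G))
      (isNormalF_comap F _ (fun f x => by simp) hH)
    rcases hcap with h0 | h1
    · exfalso
      have hz : ∀ b : G, ((1 : S), b) ∈ H → b = 1 := by
        intro b hb
        have : b ∈ H.comap (MonoidHom.inr S G) := hb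
        rw [h0] at this
        exact this
      have huniq : ∀ a b c, (a, b) ∈ H → (a, c) ∈ H → b = c := by
        intro a b c hb hc
        have := hz (b * c⁻¹) (by simpa using H.mul_mem hb (H.inv_mem hc))
        exact mul_inv_eq_one.mp this
      choose φ hφ' using hsurj
      refine hφ ⟨⟨⟨⟨φ, ?_⟩, ?_⟩, ?_, ?_⟩, ?_⟩
      · exact huniq 1 _ _ (hφ' 1) H.one_mem
      · intro a b
        exact huniq (a * b) _ _ (hφ' _) (H.mul_mem (hφ' a) (hφ' b))
      · intro f a
        exact huniq (f • a) _ _ (hφ' _) (hH.2 f _ (hφ' a))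
      · intro a b
        have := hH.1.conj_mem _ (hφ' a) (1, b)
        have h2 := huniq a _ _ (hφ' a) (by simpa using this)
        change φ a * b = b * φ a
        nth_rewrite 1 [h2]
        simp
      · funext n
        exact huniq (s n) _ _ (hφ' _) (hx n)
    · rw [eq_top_iff]
      rintro ⟨a, b⟩ _
      obtain ⟨c, hc⟩ := hsurj a
      have : c⁻¹ * b ∈ H.comap (MonoidHom.inr S G) := h1 ▸ Subgroup.mem_top _
      have := H.mul_mem hc this
      simpa using this

theorem eval_injective {N : ℕ} {s : Fin N → S} (hs : FGen F s) :
    Function.Injective (fun (φ : CHom F S G) (n : Fin N) => φ.1 (s n)) := by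
  intro φ ψ h
  have hK : IsNormalFSubgroup F (φ.1.eqLocus ψ.1) := by
    refine ⟨⟨?_⟩, ?_⟩
    · intro a ha b
      change φ.1 a = ψ.1 a at ha
      change φ.1 (b * a * b⁻¹) = ψ.1 (b * a * b⁻¹)
      rw [map_mul, map_mul, ← φ.2.2 a, map_mul, map_mul, ← ψ.2.2 a, ha]
      simp
    · intro f a ha
      change φ.1 a = ψ.1 a at ha
      change φ.1 (f • a) = ψ.1 (f • a)
      rw [φ.2.1, ψ.2.1, ha]
  have := hs _ hK (fun n => congrFun h n)
  apply Subtype.ext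
  ext a
  have h2 : a ∈ φ.1.eqLocus ψ.1 := this ▸ Subgroup.mem_top a
  exact h2

theorem card_gen_prod [Finite S] [Finite G] (N : ℕ) (hG : IsIrreducibleFGroup F G) :
    (Nat.card {x : Fin N → S × G // FGen F x} : ℤ) =
      Nat.card {x : Fin N → S // FGen F x} *
        ((Nat.card G : ℤ) ^ N - Nat.card (CHom F S G)) := by
  have e : {x : Fin N → S × G // FGen F x} ≃
      Σ s : {x : Fin N → S // FGen F x},
        {g : Fin N → G // g ∉ Set.range (fun (φ : CHom F S G) (n : Fin N) => φ.1 (s.1 n))} :=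
    { toFun := fun x =>
        have h := (gen_prod_iff F hG (fun n => (x.1 n).1) (fun n => (x.1 n).2)).1 x.2
        ⟨⟨fun n => (x.1 n).1, h.1⟩, ⟨fun n => (x.1 n).2, h.2⟩⟩
      invFun := fun y => ⟨fun n => (y.1.1 n, y.2.1 n),
        (gen_prod_iff F hG _ _).2 ⟨y.1.2, y.2.2⟩⟩
      left_inv := fun x => rfl
      right_inv := fun y => rfl }
  have hc : ∀ s : {x : Fin N → S // FGen F x},
      (Nat.card {g : Fin N → G //
        g ∉ Set.range (fun (φ : CHom F S G) (n : Fin N) => φ.1 (s.1 n))} : ℤ) =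
      (Nat.card G : ℤ) ^ N - Nat.card (CHom F S G) := by
    intro s
    have h1 := Nat.card_range_of_injective (eval_injective F (G := G) s.2)
    have h2 := Set.ncard_add_ncard_compl
      (Set.range (fun (φ : CHom F S G) (n : Fin N) => φ.1 (s.1 n)))
    rw [← Nat.card_coe_set_eq, ← Nat.card_coe_set_eq, h1, Nat.card_fun, Nat.card_fin] at h2
    rw [eq_sub_iff_add_eq']
    exact_mod_cast h2
  have := Fintype.ofFinite {x : Fin N → S // FGen F x}
  rw [Nat.card_congr e, Nat.card_sigma, Nat.cast_sum, Finset.sum_congr rfl (fun s _ => hc s)]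
  rw [Finset.sum_const, Finset.card_univ, ← Nat.card_eq_fintype_card, nsmul_eq_mul]

theorem isNormalF_center : IsNormalFSubgroup F (Subgroup.center G) := by
  refine ⟨inferInstance, fun f x hx => ?_⟩
  rw [Subgroup.mem_center_iff] at *
  intro g
  have := congrArg (f • ·) (hx (f⁻¹ • g))
  simpa [smul_mul'] using this

theorem chom_eq_one_of_nonabelian (hG : IsIrreducibleFGroup F G)
    (hn : ¬ ∀ a b : G, a * b = b * a) : Nat.card (CHom F S G) = 1 := by
  have hz : Subgroup.center G = ⊥ := by
    rcases hG.2 _ (isNormalF_center F) with h | h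
    · exact h
    · exfalso
      apply hn
      intro a b
      have : b ∈ Subgroup.center G := h ▸ Subgroup.mem_top b
      exact Subgroup.mem_center_iff.1 this a
  rw [Nat.card_eq_one_iff_unique]
  have key : ∀ (φ : CHom F S G) s, φ.1 s = 1 := by
    intro φ s
    have : φ.1 s ∈ Subgroup.center G := Subgroup.mem_center_iff.2 (fun g => (φ.2.2 s g).symm)
    rw [hz] at this
    exact this
  refine ⟨⟨fun φ ψ => ?_⟩, ⟨⟨1, fun f x => by simp, fun s g => by simp⟩⟩⟩
  apply Subtype.ext
  ext s
  rw [key, key]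

theorem card_chom_of_abelian (hc : ∀ a b : G, a * b = b * a) :
    Nat.card (CHom F G G) = hF F G :=
  Nat.card_congr (Equiv.subtypeEquivRight fun _ => ⟨fun h => h.1, fun h => ⟨h, fun _ _ => hc _ _⟩⟩)

theorem card_chom_of_not_iso (hS : IsIrreducibleFGroup F S) (hG : IsIrreducibleFGroup F G)
    (h : ¬ IsFIso F S G) : Nat.card (CHom F S G) = 1 := by
  rw [Nat.card_eq_one_iff_unique]
  have key : ∀ (φ : CHom F S G), φ.1 = 1 := by
    intro φ
    have hr : IsNormalFSubgroup F φ.1.range := by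
      refine ⟨⟨?_⟩, ?_⟩
      · rintro _ ⟨a, rfl⟩ g
        refine ⟨a, ?_⟩
        rw [← φ.2.2 a g]
        simp
      · rintro f _ ⟨a, rfl⟩
        exact ⟨f • a, φ.2.1 f a⟩
    rcases hS.2 _ (isNormalF_ker F φ.1 φ.2.1) with h1 | h1
    · rcases hG.2 _ hr with h2 | h2
      · exact MonoidHom.range_eq_bot_iff.1 h2
      · exact absurd ⟨MulEquiv.ofBijective φ.1
          ⟨(MonoidHom.ker_eq_bot_iff _).1 h1, MonoidHom.range_eq_top.1 h2⟩, φ.2.1⟩ h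
    · ext s
      have : s ∈ φ.1.ker := h1 ▸ Subgroup.mem_top s
      exact this
  refine ⟨⟨fun φ ψ => ?_⟩, ⟨⟨1, fun f x => by simp, fun s g => by simp⟩⟩⟩
  apply Subtype.ext
  rw [key, key]

end

section Family

variable {F} {k : ℕ} (G : Fin k → Type*)
    [∀ i, Group (G i)] [∀ i, MulDistribMulAction F (G i)]

/-- split off the first coordinate -/
def splitFirst {n : ℕ} (c : Fin (n + 1) → Fin k) :
    (∀ a, G (c a)) ≃* (∀ a : Fin n, G (c a.succ)) × G (c 0) where
  toFun x := (fun a => x a.succ, x 0)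
  invFun y := Fin.cons y.2 y.1
  left_inv x := by
    funext a
    refine Fin.cases ?_ (fun a => ?_) a <;> rfl
  right_inv y := rfl
  map_mul' x y := rfl

variable (F) in
open scoped Classical in
/-- number of endomorphisms, or one in the nonabelian case -/
noncomputable def qF (i : Fin k) : ℕ := if ∀ a b : G i, a * b = b * a then hF F (G i) else 1

theorem card_chom_pair (hirr : ∀ i, IsIrreducibleFGroup F (G i))
    (hnoniso : ∀ i j, i ≠ j → ¬ IsFIso F (G i) (G j)) (i j : Fin k) :
    Nat.card (CHom F (G i) (G j)) = if i = j then qF F G j else 1 := by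
  split_ifs with h
  · subst h
    unfold qF
    split_ifs with h
    · exact card_chom_of_abelian F h
    · exact chom_eq_one_of_nonabelian F (hirr i) h
  · exact card_chom_of_not_iso F (hirr i) (hirr j) (hnoniso i j h)

theorem card_chom_pi (hirr : ∀ i, IsIrreducibleFGroup F (G i))
    (hnoniso : ∀ i j, i ≠ j → ¬ IsFIso F (G i) (G j)) (i : Fin k) (n : ℕ)
    (c : Fin n → Fin k) :
    Nat.card (CHom F (∀ a, G (c a)) (G i)) =
      qF F G i ^ (Finset.univ.filter (fun a => c a = i)).card := by
  induction n with
  | zero =>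
    rw [Finset.univ_eq_empty, Finset.filter_empty, Finset.card_empty, pow_zero,
      Nat.card_eq_one_iff_unique]
    refine ⟨⟨fun φ ψ => ?_⟩, ⟨⟨1, fun f x => by simp, fun s g => by simp⟩⟩⟩
    apply Subtype.ext
    ext s
    rw [Subsingleton.elim s 1, map_one, map_one]
  | succ n ih =>
    rw [card_chom_congr F (splitFirst G c) (fun _ _ => rfl), card_chom_prod, ih,
      card_chom_pair G hirr hnoniso, Fin.card_filter_univ_succ]
    split_ifs with h
    · rw [pow_succ]
    · rw [mul_one]

theorem card_gen_pi [∀ i, Finite (G i)] (hirr : ∀ i, IsIrreducibleFGroup F (G i))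
    (hnoniso : ∀ i j, i ≠ j → ¬ IsFIso F (G i) (G j)) (N n : ℕ)
    (c : Fin n → Fin k) :
    (Nat.card {x : Fin N → (∀ a, G (c a)) // FGen F x} : ℤ) =
      ∏ i, ∏ j ∈ Finset.range (Finset.univ.filter (fun a => c a = i)).card,
        ((Nat.card (G i) : ℤ) ^ N - (qF F G i : ℤ) ^ j) := by
  induction n with
  | zero =>
    simp only [Finset.univ_eq_empty, Finset.filter_empty, Finset.card_empty, Finset.range_zero,
      Finset.prod_empty, Finset.prod_const_one]
    rw [Nat.cast_eq_one, Nat.card_eq_one_iff_unique]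
    refine ⟨inferInstance, ⟨⟨1, fun H _ _ => Subsingleton.elim _ _⟩⟩⟩
  | succ n ih =>
    rw [card_gen_congr F N (splitFirst G c) (fun _ _ => rfl), card_gen_prod F N (hirr _), ih,
      card_chom_pi G hirr hnoniso]
    simp only [Fin.card_filter_univ_succ]
    rw [← Finset.mul_prod_erase _ _ (Finset.mem_univ (c 0)),
      ← Finset.mul_prod_erase Finset.univ _ (Finset.mem_univ (c 0)), if_pos rfl,
      Finset.prod_range_succ, mul_right_comm]
    rw [Nat.cast_pow]
    congr 1
    · refine Finset.prod_congr rfl fun i hi => ?_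
      rw [if_neg (Finset.ne_of_mem_erase hi).symm]

end Family

end Helpers

open scoped Classical in
/-- Theorem on generating probabilities, counting form:
the number of `N`-tuples in `R = ∏ᵢ Gᵢ^{mᵢ}` whose normal `F`-closure is all of `R`. -/
theorem count_tuples_normalFClosure_top
    {F : Type*} [Group F] {k : ℕ} (G : Fin k → Type*)
    [∀ i, Group (G i)] [∀ i, MulDistribMulAction F (G i)] [∀ i, Finite (G i)]
    (hirr : ∀ i, IsIrreducibleFGroup F (G i))
    (hnoniso : ∀ i j, i ≠ j → ¬ IsFIso F (G i) (G j))
    (m : Fin k → ℕ) (N : ℕ) (hN : 0 < N) :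
    (Nat.card {x : Fin N → (∀ i, Fin (m i) → G i) //
        normalFClosure F (Set.range x) = ⊤} : ℤ) =
      (∏ i ∈ Finset.univ.filter (fun i => ∀ a b : G i, a * b = b * a),
          ∏ j ∈ Finset.range (m i),
            ((Nat.card (G i) : ℤ) ^ N - (hF F (G i) : ℤ) ^ j)) *
      ∏ i ∈ Finset.univ.filter (fun i => ¬ ∀ a b : G i, a * b = b * a),
          ((Nat.card (G i) : ℤ) ^ N - 1) ^ (m i) := by

  let e : (Σ i, Fin (m i)) ≃ Fin (Fintype.card (Σ i, Fin (m i))) := Fintype.equivFin _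
  let E : (∀ i, Fin (m i) → G i) ≃* (∀ a, G (e.symm a).1) :=
    { toEquiv := (Equiv.piCurry (fun i (_ : Fin (m i)) => G i)).symm.trans
        (Equiv.piCongrLeft' (fun s : (Σ i, Fin (m i)) => G s.1) e)
      map_mul' := fun x y => rfl }
  have hcard : ∀ i, (Finset.univ.filter (fun a => (e.symm a).1 = i)).card = m i := by
    intro i
    rw [← Fintype.card_subtype]
    rw [← Fintype.card_fin (m i)]
    rw [Fintype.card_congr (e.symm.subtypeEquiv (p := fun a => (e.symm a).1 = i)
      (q := fun s => s.1 = i) (fun a => Iff.rfl))]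
    refine Fintype.card_congr ⟨fun s => s.2 ▸ s.1.2, fun a => ⟨⟨i, a⟩, rfl⟩, ?_, fun a => rfl⟩
    rintro ⟨⟨i, a⟩, rfl⟩
    rfl
  simp only [normalFClosure_eq_top_iff]
  rw [card_gen_congr F N E (fun _ _ => rfl), card_gen_pi G hirr hnoniso]
  simp only [hcard]
  rw [← Finset.prod_filter_mul_prod_filter_not Finset.univ
    (fun i => ∀ a b : G i, a * b = b * a)]
  congr 1
  · refine Finset.prod_congr rfl fun i hi => ?_
    rw [show qF F G i = hF F (G i) from if_pos (Finset.mem_filter.1 hi).2]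
  · refine Finset.prod_congr rfl fun i hi => ?_
    rw [show qF F G i = 1 from if_neg (Finset.mem_filter.1 hi).2]
    simp
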